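/- There exist constants c₀ > 0 and N such that for every n ≥ N and every p with 1/n < p ≤ (log n)/n, the probability under the random G(n,p)-game measure that a pure Nash equilibrium exists is at most exp(−c₀·n·e^{−2np}). -/

import Mathlib

open scoped Classical
open Finset

/-- Best-response tables of a game with `n` binary-strategy players: player `v`'s table
assigns a best response `ω v τ ∈ {0,1}` to each (masked) strategy profile `τ`.
Only the values at profiles vanishing outside the neighborhood of `v` are ever read,
so under the uniform measure the read entries are i.i.d. uniform on `{0,1}`. -/
abbrev Tables (n : ℕ) := Fin n → (Fin n → Bool) → Bool

/-- Potential edges of a graph on `Fin n`: ordered pairs `(u,v)` with `u < v`. -/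
abbrev EdgePair (n : ℕ) := {q : Fin n × Fin n // q.1 < q.2}

/-- A sample of the Erdős–Rényi graph: an indicator of presence for each potential edge. -/
abbrev GraphSeed (n : ℕ) := EdgePair n → Bool

/-- Adjacency relation of the graph determined by a graph seed. -/
def adjB {n : ℕ} (g : GraphSeed n) (u v : Fin n) : Bool :=
  if h : u < v then g ⟨(u, v), h⟩
  else if h' : v < u then g ⟨(v, u), h'⟩
  else false

/-- Restriction of a strategy profile to the neighborhood of `v`
(strategies outside the neighborhood are replaced by `false`). -/
def maskG {n : ℕ} (g : GraphSeed n) (v : Fin n) (σ : Fin n → Bool) : Fin n → Bool :=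
  fun u => if adjB g v u then σ u else false

/-- `σ` is a pure Nash equilibrium of the game on graph `g` with tables `ω`:
every player plays a best response to its neighborhood. -/
def isPNE {n : ℕ} (g : GraphSeed n) (ω : Tables n) (σ : Fin n → Bool) : Prop :=
  ∀ v, σ v = ω v (maskG g v σ)

/-- Erdős–Rényi weight of a graph seed: each potential edge is present independently
with probability `p`. -/
noncomputable def graphWeight {n : ℕ} (p : ℝ) (g : GraphSeed n) : ℝ :=
  ∏ e : EdgePair n, if g e then p else 1 - p

/-- Probability of a table event under the uniform measure on best-response tables. -/
noncomputable def probT (n : ℕ) (A : Tables n → Prop) : ℝ :=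
  (∑ ω : Tables n, if A ω then (1 : ℝ) else 0) / (Fintype.card (Tables n) : ℝ)

/-- Joint probability of an event under the random `G(n,p)`-game measure `P_{(n,p)}`:
first draw `g ~ G(n,p)`, then independent uniform best-response tables `ω`. -/
noncomputable def probGT (n : ℕ) (p : ℝ) (A : GraphSeed n → Tables n → Prop) : ℝ :=
  ∑ g : GraphSeed n, graphWeight p g * probT n (fun ω => A g ω)

noncomputable def EG {n : ℕ} (p : ℝ) (f : GraphSeed n → ℝ) : ℝ :=
  ∑ g : GraphSeed n, graphWeight p g * f g

lemma gw_nonneg {n : ℕ} {p : ℝ} (h0 : 0 ≤ p) (h1 : p ≤ 1) (g : GraphSeed n) :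
    0 ≤ graphWeight p g := by
  unfold graphWeight
  apply Finset.prod_nonneg
  intro e _
  split_ifs <;> linarith

lemma EG_mono {n : ℕ} {p : ℝ} (h0 : 0 ≤ p) (h1 : p ≤ 1) {f f' : GraphSeed n → ℝ}
    (h : ∀ g, f g ≤ f' g) : EG p f ≤ EG p f' := by
  unfold EG
  exact Finset.sum_le_sum fun g _ => mul_le_mul_of_nonneg_left (h g) (gw_nonneg h0 h1 g)

lemma EG_add {n : ℕ} (p : ℝ) (f f' : GraphSeed n → ℝ) :
    EG p (fun g => f g + f' g) = EG p f + EG p f' := by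
  unfold EG; rw [← Finset.sum_add_distrib]; simp only [mul_add]

lemma EG_cmul {n : ℕ} (p c : ℝ) (f : GraphSeed n → ℝ) :
    EG p (fun g => c * f g) = c * EG p f := by
  unfold EG; rw [Finset.mul_sum]; refine Finset.sum_congr rfl fun g _ => by ring

lemma EG_sum {n : ℕ} {κ : Type} (p : ℝ) (s : Finset κ) (f : κ → GraphSeed n → ℝ) :
    EG p (fun g => ∑ i ∈ s, f i g) = ∑ i ∈ s, EG p (f i) := by
  unfold EG; rw [Finset.sum_comm]; simp only [Finset.mul_sum]

lemma EG_one {n : ℕ} (p : ℝ) : EG (n := n) p (fun _ => 1) = 1 := by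
  unfold EG graphWeight
  simp only [mul_one]
  have := Finset.prod_univ_sum (fun _ : EdgePair n => (Finset.univ : Finset Bool))
    (fun _ b => if b = true then p else 1 - p)
  rw [Fintype.piFinset_univ] at this
  rw [← this]
  simp

def pw {n : ℕ} (D : EdgePair n → Prop) [DecidablePred D] (g' g : GraphSeed n) : GraphSeed n :=
  fun e => if D e then g' e else g e

lemma EG_resample {n : ℕ} (p : ℝ) (D : EdgePair n → Prop) (f : GraphSeed n → ℝ) :
    EG p f = EG p (fun g' => EG p (fun g => f (pw D g' g))) := by
  have e1 : EG p f = ∑ x : GraphSeed n × GraphSeed n,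
      graphWeight p x.1 * graphWeight p x.2 * f x.1 := by
    rw [Fintype.sum_prod_type]
    have h1 := EG_one (n := n) p
    unfold EG at h1 ⊢
    refine Finset.sum_congr rfl fun g _ => ?_
    simp only [mul_one] at h1
    simp only
    rw [← Finset.sum_mul, ← Finset.mul_sum, h1, mul_one]
  have e2 : EG p (fun g' => EG p (fun g => f (pw D g' g))) =
      ∑ x : GraphSeed n × GraphSeed n,
      graphWeight p x.1 * graphWeight p x.2 * f (pw D x.1 x.2) := by
    rw [Fintype.sum_prod_type]
    unfold EG
    refine Finset.sum_congr rfl fun g _ => ?_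
    rw [Finset.mul_sum]
    refine Finset.sum_congr rfl fun g _ => by ring
  rw [e1, e2]
  symm
  refine Finset.sum_bij' (fun x _ => (pw D x.1 x.2, pw D x.2 x.1))
    (fun x _ => (pw D x.1 x.2, pw D x.2 x.1)) (by simp) (by simp) ?_ ?_ ?_
  · rintro ⟨a, b⟩ _
    ext e <;> simp only [pw] <;> split_ifs <;> rfl
  · rintro ⟨a, b⟩ _
    ext e <;> simp only [pw] <;> split_ifs <;> rfl
  · rintro ⟨a, b⟩ _
    simp only
    congr 1
    unfold graphWeight
    rw [← Finset.prod_mul_distrib, ← Finset.prod_mul_distrib]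
    refine Finset.prod_congr rfl fun e _ => ?_
    simp only [pw]
    by_cases h : D e
    · simp only [if_pos h]
    · simp only [if_neg h]; ring

def inc {n : ℕ} (v : Fin n) (e : EdgePair n) : Prop := e.1.1 = v ∨ e.1.2 = v

def oth {n : ℕ} (v : Fin n) (e : EdgePair n) : Fin n := if e.1.1 = v then e.1.2 else e.1.1

lemma adjB_symm {n : ℕ} (g : GraphSeed n) (u v : Fin n) : adjB g u v = adjB g v u := by
  unfold adjB
  rcases lt_trichotomy u v with h | h | h
  · simp [h, h.not_gt]
  · simp [h]
  · simp [h, h.not_gt]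

lemma adjB_irrefl {n : ℕ} (g : GraphSeed n) (v : Fin n) : adjB g v v = false := by
  simp [adjB]

lemma adjB_pw_in {n : ℕ} (g' g : GraphSeed n) (v u : Fin n) :
    adjB (pw (inc v) g' g) v u = adjB g' v u := by
  unfold adjB pw inc
  simp

lemma adjB_pw_out {n : ℕ} (g' g : GraphSeed n) (v x y : Fin n) (hx : x ≠ v) (hy : y ≠ v) :
    adjB (pw (inc v) g' g) x y = adjB g x y := by
  unfold adjB pw inc
  simp [hx, hy]

lemma adjB_oth {n : ℕ} (g : GraphSeed n) (v : Fin n) (e : EdgePair n) (h : inc v e) :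
    adjB g v (oth v e) = g e := by
  obtain ⟨⟨a, b⟩, hab⟩ := e
  simp only [inc] at h
  simp only [oth]
  simp only at hab
  rcases h with h | h
  · subst h; simp [adjB, hab]
  · subst h; simp [adjB, hab, hab.ne, hab.not_gt]

lemma prod_oth {n : ℕ} (v : Fin n) (A : Finset (Fin n)) (hv : v ∉ A)
    (P : EdgePair n → ℝ) (R : Fin n → ℝ) (h : ∀ e, inc v e → P e = R (oth v e)) :
    ∏ e ∈ Finset.univ.filter (fun e => inc v e ∧ oth v e ∈ A), P e = ∏ x ∈ A, R x := by
  refine Finset.prod_bij (fun e _ => oth v e) ?_ ?_ ?_ ?_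
  · intro e he; simp at he; exact he.2
  · rintro ⟨⟨a, b⟩, hab⟩ h1 ⟨⟨c, d⟩, hcd⟩ h2 heq
    rw [Finset.mem_filter] at h1 h2
    simp only [inc] at h1 h2
    simp only [oth] at heq
    simp only at hab hcd
    apply Subtype.ext
    simp only [Prod.mk.injEq]
    replace h1 := h1.2.1
    replace h2 := h2.2.1
    grind
  · intro x hx
    have hne : x ≠ v := fun h => hv (h ▸ hx)
    rcases lt_or_gt_of_ne hne with h | h
    · exact ⟨⟨(x, v), h⟩, by rw [Finset.mem_filter]; simp [inc, oth, hne, hx], by simp [oth, hne]⟩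
    · exact ⟨⟨(v, x), h⟩, by rw [Finset.mem_filter]; simp [inc, oth, hx], by simp [oth]⟩
  · intro e he
    simp at he
    exact h e he.1

lemma EG_prod {n : ℕ} (p : ℝ) (v : Fin n) (A : Finset (Fin n)) (hv : v ∉ A)
    (c : Fin n → Bool → ℝ) :
    EG p (fun g => ∏ x ∈ A, c x (adjB g v x)) =
      ∏ x ∈ A, (p * c x true + (1 - p) * c x false) := by
  have h1 : ∀ g : GraphSeed n, graphWeight p g * ∏ x ∈ A, c x (adjB g v x) =
      ∏ e : EdgePair n, ((if g e then p else 1 - p) *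
        if inc v e ∧ oth v e ∈ A then c (oth v e) (g e) else 1) := by
    intro g
    rw [Finset.prod_mul_distrib, ← Finset.prod_filter]
    rw [prod_oth v A hv (fun e => c (oth v e) (g e)) (fun x => c x (adjB g v x))]
    · rfl
    · intro e he; rw [adjB_oth g v e he]
  unfold EG
  simp only [h1]
  have := Finset.prod_univ_sum (fun _ : EdgePair n => (Finset.univ : Finset Bool))
    (fun e b => (if b = true then p else 1 - p) *
        if inc v e ∧ oth v e ∈ A then c (oth v e) b else 1)
  rw [Fintype.piFinset_univ] at this
  rw [← this, ← prod_oth v A hv (fun e => p * c (oth v e) true + (1 - p) * c (oth v e) false) _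
    (fun _ _ => rfl), Finset.prod_filter]
  refine Finset.prod_congr rfl fun e _ => ?_
  simp only [Fintype.univ_bool, Finset.mem_singleton, Bool.true_eq_false, not_false_eq_true,
    Finset.sum_insert, Finset.sum_singleton]
  by_cases h : inc v e ∧ oth v e ∈ A
  · simp only [if_pos h]; simp
  · simp only [if_neg h]; simp

def nb {n : ℕ} (U : Finset (Fin n)) (g : GraphSeed n) (v : Fin n) : Finset (Fin n) :=
  U.filter (fun x => adjB g v x = true)

lemma EG_exp {n : ℕ} (p l : ℝ) (v : Fin n) (A : Finset (Fin n)) (hv : v ∉ A) :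
    EG p (fun g => Real.exp (l * (nb A g v).card)) = (1 + p * (Real.exp l - 1)) ^ A.card := by
  have := EG_prod p v A hv (fun _ b => if b then Real.exp l else 1)
  rw [Finset.prod_const] at this
  convert this using 2
  · ext g
    unfold nb
    rw [← Finset.prod_filter, Finset.prod_const, ← Real.exp_nat_mul, mul_comm]
  · simp; ring

lemma EG_empty {n : ℕ} (p : ℝ) (v : Fin n) (A : Finset (Fin n)) (hv : v ∉ A) :
    EG p (fun g => if nb A g v = ∅ then (1:ℝ) else 0) = (1 - p) ^ A.card := by
  have := EG_prod p v A hv (fun _ b => if b = true then 0 else 1)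
  rw [Finset.prod_const] at this
  convert this using 2
  · ext g
    unfold nb
    split_ifs with h
    · rw [Finset.filter_eq_empty_iff] at h
      rw [Finset.prod_eq_one]
      intro x hx; simp [h hx]
    · replace h := Finset.nonempty_iff_ne_empty.2 h
      obtain ⟨x, hx⟩ := h
      simp at hx
      rw [Finset.prod_eq_zero hx.1]; simp [hx.2]
  · simp

lemma EG_single {n : ℕ} (p : ℝ) (v u : Fin n) (A : Finset (Fin n)) (hv : v ∉ A) (hu : u ∈ A) :
    EG p (fun g => if nb A g v = {u} then (1:ℝ) else 0) = p * (1 - p) ^ (A.card - 1) := by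
  have := EG_prod p v A hv (fun x b => if x = u then (if b = true then 1 else 0)
    else (if b = true then 0 else 1))
  rw [← Finset.mul_prod_erase A _ hu, ← Finset.card_erase_of_mem hu] at *
  rw [Finset.prod_congr (g := fun _ => 1 - p) rfl, Finset.prod_const] at this
  · convert this using 2
    · ext g
      unfold nb
      split_ifs with h
      · rw [Finset.prod_eq_one]
        intro x hx
        have h2 := Finset.ext_iff.1 h x
        simp [hx] at h2
        by_cases hxu : x = u
        · simp [hxu] at h2 ⊢; exact h2
        · simp [hxu, h2]
      · symm
        by_contra hne
        apply h
        replace hne := Finset.prod_ne_zero_iff.1 hne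
        ext x
        simp
        constructor
        · rintro ⟨hx, ha⟩
          by_contra hxu
          have := hne x hx
          simp [hxu, ha] at this
        · rintro rfl
          have := hne x hu
          simp at this
          exact ⟨hu, this⟩
    · simp
  · intro x hx
    simp at hx
    simp [hx.1]

def sing {n : ℕ} (v : Fin n) : Fin n → Bool := fun x => decide (x = v)

def zer {n : ℕ} : Fin n → Bool := fun _ => false

lemma sing_ne {n : ℕ} (v : Fin n) : sing v ≠ zer := by
  intro h
  have := congrFun h v
  simp [sing, zer] at this

def MP {n : ℕ} (u v : Fin n) (ω : Tables n) : Prop :=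
  ω u zer = false ∧ ω u (sing v) = true ∧ ω v zer = true ∧ ω v (sing u) = false

def isoE {n : ℕ} (U : Finset (Fin n)) (g : GraphSeed n) (u v : Fin n) : Prop :=
  adjB g u v = true ∧ (∀ x ∈ U, x ≠ v → adjB g u x = false) ∧
    (∀ x ∈ U, x ≠ u → adjB g v x = false)

def noMP {n : ℕ} (U F : Finset (Fin n)) (g : GraphSeed n) (ω : Tables n) : Prop :=
  ∀ u ∈ F, ∀ v ∈ F, isoE U g u v → ¬ MP u v ω

lemma noMP_of_PNE {n : ℕ} (g : GraphSeed n) (ω : Tables n) (h : ∃ σ, isPNE g ω σ) :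
    noMP Finset.univ Finset.univ g ω := by
  obtain ⟨σ, hσ⟩ := h
  rintro u - v - ⟨h1, h2, h3⟩ ⟨m1, m2, m3, m4⟩
  have h1' : adjB g v u = true := by rw [adjB_symm]; exact h1
  have mu : maskG g u σ = if σ v then sing v else zer := by
    ext x
    by_cases hx : x = v
    · subst hx; cases h : σ x <;> simp [maskG, h1, h, sing, zer]
    · cases h : σ v <;> simp [maskG, h2 x (Finset.mem_univ x) hx, sing, zer, hx]
  have mv : maskG g v σ = if σ u then sing u else zer := by
    ext x
    by_cases hx : x = u
    · subst hx; cases h : σ x <;> simp [maskG, h1', h, sing, zer]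
    · cases h : σ u <;> simp [maskG, h3 x (Finset.mem_univ x) hx, sing, zer, hx]
  have a := hσ u
  have b := hσ v
  rw [mu] at a
  rw [mv] at b
  cases hu : σ u <;> cases hv : σ v <;> rw [hu, hv] at a b <;>
    simp [m1, m2, m3, m4] at a b

lemma noMP_step {n : ℕ} {U F : Finset (Fin n)} {g : GraphSeed n} {ω : Tables n} (v : Fin n)
    (hFU : F ⊆ U) (h : noMP U F g ω) :
    noMP (U.erase v) ((F.erase v) \ nb (U.erase v) g v) g ω := by
  rintro a ha b hb ⟨h1, h2, h3⟩
  simp only [Finset.mem_sdiff, Finset.mem_erase, nb, Finset.mem_filter] at ha hb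
  have ha' : adjB g a v = false := by
    rw [adjB_symm]; by_contra hc; exact ha.2 ⟨⟨ha.1.1, hFU ha.1.2⟩, by simpa using hc⟩
  have hb' : adjB g b v = false := by
    rw [adjB_symm]; by_contra hc; exact hb.2 ⟨⟨hb.1.1, hFU hb.1.2⟩, by simpa using hc⟩
  refine h a ha.1.2 b hb.1.2 ⟨h1, ?_, ?_⟩
  · intro x hx hxb
    by_cases hxv : x = v
    · rw [hxv]; exact ha'
    · exact h2 x (by simp [hxv, hx]) hxb
  · intro x hx hxb
    by_cases hxv : x = v
    · rw [hxv]; exact hb'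
    · exact h3 x (by simp [hxv, hx]) hxb

lemma noMP_congr {n : ℕ} {U F : Finset (Fin n)} {g g' : GraphSeed n} {ω : Tables n}
    (hFU : F ⊆ U) (hg : ∀ x ∈ U, ∀ y ∈ U, adjB g x y = adjB g' x y) (h : noMP U F g ω) :
    noMP U F g' ω := by
  rintro a ha b hb ⟨h1, h2, h3⟩
  refine h a ha b hb ⟨?_, ?_, ?_⟩
  · rw [hg a (hFU ha) b (hFU hb)]; exact h1
  · intro x hx hxb; rw [hg a (hFU ha) x hx]; exact h2 x hx hxb
  · intro x hx hxb; rw [hg b (hFU hb) x hx]; exact h3 x hx hxb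

lemma probT_eq {n : ℕ} (A : Tables n → Prop) :
    probT n A = ((Finset.univ.filter A).card : ℝ) / (Fintype.card (Tables n) : ℝ) := by
  unfold probT
  rw [Finset.sum_boole]

lemma probT_mono {n : ℕ} {A B : Tables n → Prop} (h : ∀ ω, A ω → B ω) :
    probT n A ≤ probT n B := by
  rw [probT_eq, probT_eq]
  apply div_le_div_of_nonneg_right _ (by positivity)
  exact_mod_cast Finset.card_le_card (Finset.monotone_filter_right _ fun ω _ => h ω)

lemma probT_nonneg {n : ℕ} (A : Tables n → Prop) : 0 ≤ probT n A := by
  rw [probT_eq]; positivity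

lemma probT_le_one {n : ℕ} (A : Tables n → Prop) : probT n A ≤ 1 := by
  rw [probT_eq]
  apply div_le_one_of_le₀ _ (by positivity)
  exact_mod_cast Finset.card_le_univ _

def fixT {n : ℕ} (u v : Fin n) (ω : Tables n) : Tables n := fun x τ =>
  if x = u ∧ τ = zer then false else if x = u ∧ τ = sing v then true
  else if x = v ∧ τ = zer then true else if x = v ∧ τ = sing u then false else ω x τ

lemma MP_fixT {n : ℕ} {u v : Fin n} (huv : u ≠ v) (ω : Tables n) : MP u v (fixT u v ω) := by
  simp [MP, fixT, huv.symm, sing_ne]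

lemma probT_MP {n : ℕ} {u v : Fin n} (huv : u ≠ v) (B : Tables n → Prop)
    (hB : ∀ ω ω' : Tables n, (∀ x, x ≠ u → x ≠ v → ω x = ω' x) → B ω → B ω') :
    probT n (fun ω => ¬ MP u v ω ∧ B ω) ≤ (1 - 1 / 16) * probT n B := by
  have key : (Finset.univ.filter B).card ≤
      (Finset.univ.filter (fun ω : Tables n => MP u v ω ∧ B ω)).card * 16 := by
    have : (16 : ℕ) = (Finset.univ : Finset (Bool × Bool × Bool × Bool)).card := by decide
    rw [this, ← Finset.card_product]
    apply Finset.card_le_card_of_injOn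
      (fun ω => (fixT u v ω, (ω u zer, ω u (sing v), ω v zer, ω v (sing u))))
    · intro ω hω
      simp at hω
      simp only [Finset.coe_product, Set.mem_prod, Finset.mem_coe, Finset.mem_filter,
        Finset.mem_univ, true_and, and_true]
      refine ⟨MP_fixT huv ω, hB ω _ ?_ hω⟩
      intro x hx hy
      ext τ
      simp [fixT, hx, hy]
    · intro ω _ ω' _ h
      simp only [Prod.mk.injEq] at h
      obtain ⟨h0, h1, h2, h3, h4⟩ := h
      ext x τ
      have h5 := congrFun (congrFun h0 x) τ
      simp only [fixT] at h5
      split_ifs at h5 with a b c d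
      · rw [a.1, a.2, h1]
      · rw [b.1, b.2, h2]
      · rw [c.1, c.2, h3]
      · rw [d.1, d.2, h4]
      · rw [h5]
  have split : (Finset.univ.filter B).card =
      (Finset.univ.filter (fun ω : Tables n => MP u v ω ∧ B ω)).card +
      (Finset.univ.filter (fun ω : Tables n => ¬ MP u v ω ∧ B ω)).card := by
    rw [← Finset.card_union_of_disjoint]
    · congr 1
      ext ω
      simp; tauto
    · rw [Finset.disjoint_left]
      intro ω h1 h2
      simp at h1 h2; exact h2.1 h1.1
  rw [probT_eq, probT_eq, ← mul_div_assoc]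
  gcongr
  have k : ((Finset.univ.filter B).card : ℝ) ≤
      ((Finset.univ.filter (fun ω : Tables n => MP u v ω ∧ B ω)).card : ℝ) * 16 := by
    exact_mod_cast key
  have s : ((Finset.univ.filter B).card : ℝ) =
      ((Finset.univ.filter (fun ω : Tables n => MP u v ω ∧ B ω)).card : ℝ) +
      ((Finset.univ.filter (fun ω : Tables n => ¬ MP u v ω ∧ B ω)).card : ℝ) := by
    exact_mod_cast split
  have fin : ((Finset.univ.filter (fun ω : Tables n => ¬ MP u v ω ∧ B ω)).card : ℝ) ≤
      (1 - 1 / 16) * ((Finset.univ.filter B).card : ℝ) := by linarith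
  refine le_trans (le_of_eq ?_) fin
  congr

lemma noMP_tables {n : ℕ} {U F : Finset (Fin n)} {g : GraphSeed n} {u v : Fin n}
    (hu : u ∉ F) (hv : v ∉ F) (ω ω' : Tables n) (h : ∀ x, x ≠ u → x ≠ v → ω x = ω' x)
    (hB : noMP U F g ω) : noMP U F g ω' := by
  intro a ha b hb hi hm
  apply hB a ha b hb hi
  unfold MP at *
  rw [h a (fun e => hu (e ▸ ha)) (fun e => hv (e ▸ ha)),
    h b (fun e => hu (e ▸ hb)) (fun e => hv (e ▸ hb))]
  exact hm

noncomputable def QQ {n : ℕ} (p : ℝ) (U F : Finset (Fin n)) : ℝ :=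
  EG p (fun g => probT n (noMP U F g))

/-- inner second exposure -/
lemma inner_bound {n : ℕ} {p l f0 : ℝ} (hp0 : 0 ≤ p) (hp1 : p ≤ 1)
    (U F : Finset (Fin n)) (hFU : F ⊆ U) (v u : Fin n) (hvF : v ∈ F) (huF : u ∈ F)
    (huv : u ≠ v)
    (IH : ∀ F' : Finset (Fin n), F' ⊆ (U.erase v).erase u →
      QQ p ((U.erase v).erase u) F' ≤ Real.exp (l * (f0 - F'.card)))
    (g' : GraphSeed n) (hT : nb (U.erase v) g' v = {u}) :
    EG p (fun g => probT n (noMP U F (pw (inc v) g' g))) ≤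
      Real.exp (l * (f0 - F.card)) * (Real.exp (2 * l) *
        ((1 + p * (Real.exp l - 1)) ^ (F.card - 2) - 1 / 16 * (1 - p) ^ (U.card - 2))) := by
  set U2 := (U.erase v).erase u with hU2
  set F2 := (F.erase v).erase u with hF2
  have hF2U2 : F2 ⊆ U2 := Finset.erase_subset_erase _ (Finset.erase_subset_erase _ hFU)
  have hcF : F2.card = F.card - 2 := by
    rw [hF2, Finset.card_erase_of_mem (by simp [huv, huF]), Finset.card_erase_of_mem hvF]; omega
  have hcU : U2.card = U.card - 2 := by
    rw [hU2, Finset.card_erase_of_mem (by simp [huv, hFU huF]),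
      Finset.card_erase_of_mem (hFU hvF)]; omega
  have hcF' : (F2.card : ℝ) = F.card - 2 := by
    have : 2 ≤ F.card := by
      have : ({u, v} : Finset (Fin n)) ⊆ F := by
        intro x hx; simp at hx; rcases hx with rfl | rfl <;> assumption
      simpa [Finset.card_pair huv] using Finset.card_le_card this
    rw [hcF]; push_cast [this]; ring
  have huU2 : u ∉ U2 := by simp [hU2]
  have hvU2 : v ∉ U2 := by simp [hU2]
  rw [EG_resample p (inc u)]
  -- implication
  have agree : ∀ g'' g : GraphSeed n, ∀ x ∈ U2, ∀ y ∈ U2,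
      adjB (pw (inc v) g' (pw (inc u) g'' g)) x y = adjB g x y := by
    intro g'' g x hx y hy
    simp only [hU2, Finset.mem_erase] at hx hy
    rw [adjB_pw_out _ _ _ _ _ hx.2.1 hy.2.1, adjB_pw_out _ _ _ _ _ hx.1 hy.1]
  have hnb1 : ∀ g, nb (U.erase v) (pw (inc v) g' g) v = {u} := by
    intro g; rw [← hT]; unfold nb; simp only [adjB_pw_in]
  have hnb2 : ∀ g'' g, nb U2 (pw (inc v) g' (pw (inc u) g'' g)) u = nb U2 g'' u := by
    intro g'' g
    unfold nb
    apply Finset.filter_congr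
    intro x hx
    simp only [hU2, Finset.mem_erase] at hx
    rw [adjB_pw_out _ _ _ _ _ huv hx.2.1, adjB_pw_in]
  have impl : ∀ g'' g ω, noMP U F (pw (inc v) g' (pw (inc u) g'' g)) ω →
      noMP U2 (F2 \ nb U2 g'' u) g ω := by
    intro g'' g ω h
    have h1 := noMP_step v hFU h
    rw [hnb1] at h1
    have h2 := noMP_step u (Finset.sdiff_subset.trans (Finset.erase_subset_erase _ hFU)) h1
    rw [← hU2, hnb2] at h2
    have e : (F.erase v \ {u}).erase u = F2 := by
      rw [hF2]; ext x; simp; tauto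
    rw [e] at h2
    exact noMP_congr (Finset.sdiff_subset.trans hF2U2) (agree g'' g) h2
  have impl2 : ∀ g'' g ω, nb U2 g'' u = ∅ → noMP U F (pw (inc v) g' (pw (inc u) g'' g)) ω →
      ¬ MP v u ω := by
    intro g'' g ω hW h
    refine h v hvF u huF ⟨?_, ?_, ?_⟩
    · have : u ∈ nb (U.erase v) (pw (inc v) g' (pw (inc u) g'' g)) v := by rw [hnb1]; simp
      simp only [nb, Finset.mem_filter] at this
      exact this.2
    · intro x hx hxu
      by_cases hxv : x = v
      · rw [hxv]; exact adjB_irrefl _ _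
      have : x ∉ nb (U.erase v) (pw (inc v) g' (pw (inc u) g'' g)) v := by rw [hnb1]; simp [hxu]
      simpa [nb, hxv, hx] using this
    · intro x hx hxv
      by_cases hxu : x = u
      · rw [hxu]; exact adjB_irrefl _ _
      have : x ∉ nb U2 (pw (inc v) g' (pw (inc u) g'' g)) u := by rw [hnb2, hW]; simp
      simpa [nb, hxv, hx, hU2, hxu] using this
  have pt : ∀ g'' : GraphSeed n,
      EG p (fun g => probT n (noMP U F (pw (inc v) g' (pw (inc u) g'' g)))) ≤
      Real.exp (l * (f0 - F2.card)) * (Real.exp (l * (nb F2 g'' u).card) +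
        (- (1 / 16)) * if nb U2 g'' u = ∅ then 1 else 0) := by
    intro g''
    by_cases hW : nb U2 g'' u = ∅
    · have hW' : nb F2 g'' u = ∅ := by
        apply Finset.subset_empty.1; rw [← hW]; exact Finset.filter_subset_filter _ hF2U2
      have : EG p (fun g => probT n (noMP U F (pw (inc v) g' (pw (inc u) g'' g)))) ≤
          EG p (fun g => (1 - 1 / 16) * probT n (noMP U2 F2 g)) := by
        apply EG_mono hp0 hp1
        intro g
        refine le_trans (probT_mono (B := fun ω => ¬ MP v u ω ∧ noMP U2 F2 g ω) ?_)
          (probT_MP huv.symm _ ?_)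
        · intro ω h
          refine ⟨impl2 g'' g ω hW h, ?_⟩
          have := impl g'' g ω h
          rwa [hW, Finset.sdiff_empty] at this
        · exact noMP_tables (fun h => hvU2 (hF2U2 h)) (fun h => huU2 (hF2U2 h))
      rw [EG_cmul] at this
      refine this.trans ?_
      have h3 := IH F2 hF2U2
      unfold QQ at h3
      rw [hW', if_pos hW]
      simp only [Finset.card_empty, Nat.cast_zero, mul_zero, Real.exp_zero]
      have h4 := mul_le_mul_of_nonneg_left h3 (show (0:ℝ) ≤ 1 - 1/16 by norm_num)
      refine h4.trans (le_of_eq ?_)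
      ring
    · rw [if_neg hW, mul_zero, add_zero]
      have h1 : EG p (fun g => probT n (noMP U F (pw (inc v) g' (pw (inc u) g'' g)))) ≤
          QQ p U2 (F2 \ nb U2 g'' u) :=
        EG_mono hp0 hp1 fun g => probT_mono (impl g'' g)
      refine (h1.trans (IH _ (Finset.sdiff_subset.trans hF2U2))).trans (le_of_eq ?_)
      rw [← Real.exp_add]
      congr 1
      have : F2 \ nb U2 g'' u = F2 \ nb F2 g'' u := by
        ext x; simp only [nb, Finset.mem_sdiff, Finset.mem_filter]
        constructor
        · rintro ⟨a, b⟩; exact ⟨a, fun c => b ⟨hF2U2 c.1, c.2⟩⟩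
        · rintro ⟨a, b⟩; exact ⟨a, fun c => b ⟨a, c.2⟩⟩
      rw [this, Finset.cast_card_sdiff (show nb _ _ _ ⊆ _ from Finset.filter_subset _ _)]
      ring
  refine (EG_mono hp0 hp1 pt).trans (le_of_eq ?_)
  rw [EG_cmul, EG_add, EG_cmul, EG_exp p l u F2 (fun h => huU2 (hF2U2 h)),
    EG_empty p u U2 huU2, ← mul_assoc, ← Real.exp_add, hcF', hcF, hcU]
  congr 1
  · congr 1; ring
  · ring

lemma step_bound {n : ℕ} {p l f0 : ℝ} (hp0 : 0 ≤ p) (hp1 : p ≤ 1)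
    (U F : Finset (Fin n)) (hFU : F ⊆ U) (v : Fin n) (hvF : v ∈ F)
    (IH : ∀ U' F' : Finset (Fin n), U'.card < U.card → F' ⊆ U' →
      QQ p U' F' ≤ Real.exp (l * (f0 - F'.card))) :
    QQ p U F ≤ Real.exp (l * (f0 - F.card)) *
      (Real.exp l * (1 + p * (Real.exp l - 1)) ^ (F.card - 1) +
        ((F.card - 1 : ℕ) : ℝ) * (p * (1 - p) ^ (U.card - 2)) *
        (Real.exp (2 * l) * ((1 + p * (Real.exp l - 1)) ^ (F.card - 2) - 1
          - 1 / 16 * (1 - p) ^ (U.card - 2)))) := by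
  set R : ℝ := Real.exp (2 * l) * ((1 + p * (Real.exp l - 1)) ^ (F.card - 2) - 1
          - 1 / 16 * (1 - p) ^ (U.card - 2)) with hR
  set U1 := U.erase v with hU1
  set F1 := F.erase v with hF1
  have hvU : v ∈ U := hFU hvF
  have hF1U1 : F1 ⊆ U1 := Finset.erase_subset_erase _ hFU
  have hcF : F1.card = F.card - 1 := Finset.card_erase_of_mem hvF
  have hcU : U1.card = U.card - 1 := Finset.card_erase_of_mem hvU
  have hFpos : 1 ≤ F.card := Finset.card_pos.2 ⟨v, hvF⟩
  have hUpos : 1 ≤ U.card := Finset.card_pos.2 ⟨v, hvU⟩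
  have hcF' : (F1.card : ℝ) = F.card - 1 := by rw [hcF]; push_cast [hFpos]; ring
  have pt : ∀ g' : GraphSeed n, EG p (fun g => probT n (noMP U F (pw (inc v) g' g))) ≤
      Real.exp (l * (f0 - F.card)) * (Real.exp l * Real.exp (l * (nb F1 g' v).card) +
        ∑ u ∈ F1, R * if nb U1 g' v = {u} then 1 else 0) := by
    intro g'
    by_cases hT : ∃ u ∈ F1, nb U1 g' v = {u}
    · obtain ⟨u, hu, hT⟩ := hT
      have hu' := hu
      simp only [hF1, Finset.mem_erase] at hu'
      have h1 := inner_bound (l := l) (f0 := f0) hp0 hp1 U F hFU v u hvF hu'.2 hu'.1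
        (fun F' hF' => IH _ F' ((Finset.card_erase_le).trans_lt (by rw [← hU1, hcU]; omega)) hF')
        g' hT
      refine h1.trans (le_of_eq ?_)
      have hn : nb F1 g' v = {u} := by
        have e : nb F1 g' v = nb U1 g' v ∩ F1 := by
          ext x; simp only [nb, Finset.mem_inter, Finset.mem_filter]
          exact ⟨fun h => ⟨⟨hF1U1 h.1, h.2⟩, h.1⟩, fun h => ⟨h.2, h.1.2⟩⟩
        rw [e, hT]; simp [hu]
      rw [hn, hT]
      have : ∑ x ∈ F1, R * (if ({u} : Finset (Fin n)) = {x} then (1:ℝ) else 0) = R := by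
        simp [hu]
      rw [this, ← Real.exp_add, hR]
      simp only [Finset.card_singleton, Nat.cast_one, mul_one]
      rw [show l + l = 2 * l by ring]
      ring
    · push Not at hT
      rw [Finset.sum_eq_zero (fun u hu => by rw [if_neg (hT u hu), mul_zero]), add_zero]
      have h1 : EG p (fun g => probT n (noMP U F (pw (inc v) g' g))) ≤
          QQ p U1 (F1 \ nb U1 g' v) := by
        refine EG_mono hp0 hp1 fun g => probT_mono fun ω h => ?_
        have h2 := noMP_step v hFU h
        have e : nb U1 (pw (inc v) g' g) v = nb U1 g' v := by
          unfold nb; simp only [adjB_pw_in]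
        rw [← hU1, ← hF1, e] at h2
        refine noMP_congr (Finset.sdiff_subset.trans hF1U1) ?_ h2
        intro x hx y hy
        simp only [hU1, Finset.mem_erase] at hx hy
        exact adjB_pw_out _ _ _ _ _ hx.1 hy.1
      refine (h1.trans (IH _ _ (by omega) (Finset.sdiff_subset.trans hF1U1))).trans
        (le_of_eq ?_)
      rw [← Real.exp_add, ← Real.exp_add]
      congr 1
      have : F1 \ nb U1 g' v = F1 \ nb F1 g' v := by
        ext x; simp only [nb, Finset.mem_sdiff, Finset.mem_filter]
        constructor
        · rintro ⟨a, b⟩; exact ⟨a, fun c => b ⟨hF1U1 c.1, c.2⟩⟩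
        · rintro ⟨a, b⟩; exact ⟨a, fun c => b ⟨a, c.2⟩⟩
      rw [this, Finset.cast_card_sdiff (show nb _ _ _ ⊆ _ from Finset.filter_subset _ _), hcF']
      ring
  have hvU1 : v ∉ U1 := by simp [hU1]
  have hvF1 : v ∉ F1 := by simp [hF1]
  unfold QQ
  rw [EG_resample p (inc v)]
  refine (EG_mono hp0 hp1 pt).trans (le_of_eq ?_)
  rw [EG_cmul, EG_add, EG_cmul, EG_sum, EG_exp p l v F1 hvF1]
  rw [Finset.sum_congr rfl (fun u hu => by
    rw [EG_cmul, EG_single p v u U1 hvU1 (hF1U1 hu)])]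
  rw [Finset.sum_const, hcF, hcU, nsmul_eq_mul, show U.card - 1 - 1 = U.card - 2 by omega]
  ring

set_option maxHeartbeats 1600000 in
lemma analytic (n f N : ℕ) (p : ℝ) (hn : 16 ≤ n) (h1 : 1 < n * p) (hp0 : 0 ≤ p) (hp4 : p ≤ 1 / 4)
    (hd : (n * p) * p ≤ 1) (hfN : f ≤ N) (hNn : N ≤ n) (hf : (n : ℝ) / 2 < f)
    (l : ℝ) (hl : l = 1 / 200000 * Real.exp (-(2 * (n * p)))) :
    Real.exp l * (1 + p * (Real.exp l - 1)) ^ (f - 1) +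
        ((f - 1 : ℕ) : ℝ) * (p * (1 - p) ^ (N - 2)) *
        (Real.exp (2 * l) * ((1 + p * (Real.exp l - 1)) ^ (f - 2) - 1
          - 1 / 16 * (1 - p) ^ (N - 2))) ≤ 1 := by
  have hn' : (16 : ℝ) ≤ n := by exact_mod_cast hn
  have hf8 : 8 < f := by
    have : (8 : ℝ) < f := by linarith
    exact_mod_cast this
  set d : ℝ := n * p with hdd
  set E : ℝ := Real.exp (-(2 * d)) with hE
  have hE0 : 0 < E := Real.exp_pos _
  have hE1 : E ≤ 1 := by rw [hE, Real.exp_le_one_iff]; linarith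
  have hl0 : 0 < l := by rw [hl]; positivity
  have hl1 : l ≤ 1 / 200000 := by rw [hl]; linarith
  have hdE : d * E ≤ 1 := by
    have h2 : d ≤ Real.exp (2 * d) := by have := Real.add_one_le_exp (2 * d); linarith
    calc d * E ≤ Real.exp (2 * d) * E := by gcongr
      _ = 1 := by rw [hE, ← Real.exp_add]; simp
  have hld : l * d = 1 / 200000 * (d * E) := by rw [hl]; ring
  have hld0 : 0 < l * d := by positivity
  have hld1 : l * d ≤ 1 / 200000 := by rw [hld]; linarith
  have hexp : ∀ x : ℝ, 0 ≤ x → x ≤ 1 → Real.exp x ≤ 1 + 2 * x := by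
    intro x hx0 hx1
    have h := Real.abs_exp_sub_one_le (x := x) (by rw [abs_of_nonneg hx0]; exact hx1)
    rw [abs_of_nonneg hx0] at h
    have := le_abs_self (Real.exp x - 1)
    linarith
  have hel : Real.exp l ≤ 1 + 2 * l := hexp l hl0.le (by linarith)
  have hel1 : 1 ≤ Real.exp l := Real.one_le_exp hl0.le
  have hM0 : 0 ≤ 1 + p * (Real.exp l - 1) := by
    have : 0 ≤ p * (Real.exp l - 1) := mul_nonneg hp0 (by linarith)
    linarith
  have hM : ∀ k : ℕ, k ≤ n → (1 + p * (Real.exp l - 1)) ^ k ≤ Real.exp (2 * (l * d)) := by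
    intro k hk
    have hk' : (k : ℝ) ≤ n := by exact_mod_cast hk
    calc (1 + p * (Real.exp l - 1)) ^ k ≤ (Real.exp (2 * (p * l))) ^ k := by
          gcongr
          have := Real.add_one_le_exp (2 * (p * l))
          nlinarith
      _ = Real.exp (k * (2 * (p * l))) := by rw [Real.exp_nat_mul]
      _ ≤ Real.exp (2 * (l * d)) := by
          apply Real.exp_le_exp.2
          have : (k : ℝ) * (2 * (p * l)) ≤ n * (2 * (p * l)) := by gcongr
          rw [hdd]; linarith
  have t1 : Real.exp l * (1 + p * (Real.exp l - 1)) ^ (f - 1) ≤ 1 + 6 * (l * d) := by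
    calc Real.exp l * (1 + p * (Real.exp l - 1)) ^ (f - 1)
        ≤ Real.exp l * Real.exp (2 * (l * d)) := by
          gcongr; exact hM _ (by omega)
      _ = Real.exp (l + 2 * (l * d)) := by rw [Real.exp_add]
      _ ≤ Real.exp (3 * (l * d)) := by
          apply Real.exp_le_exp.2; nlinarith
      _ ≤ 1 + 2 * (3 * (l * d)) := hexp _ (by positivity) (by linarith)
      _ = _ := by ring
  have t2 : (1 + p * (Real.exp l - 1)) ^ (f - 2) - 1 ≤ 4 * (l * d) := by
    have := hM (f - 2) (by omega)
    have := hexp (2 * (l * d)) (by positivity) (by linarith)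
    linarith
  have he2 : Real.exp (2 * l) ≤ 2 := by
    have := hexp (2 * l) (by positivity) (by linarith); linarith
  have he1 : 1 ≤ Real.exp (2 * l) := Real.one_le_exp (by positivity)
  set q : ℝ := (1 - p) ^ (N - 2) with hq
  have hq0 : 0 ≤ q := pow_nonneg (by linarith) _
  have hNcast : ((N - 2 : ℕ) : ℝ) = N - 2 := by push_cast [show 2 ≤ N by omega]; ring
  have hdq : d * q ≤ 2 := by
    have a1 : q ≤ Real.exp (-(d / 2) + 2 * p) := by
      calc q ≤ (Real.exp (-p)) ^ (N - 2) := by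
            rw [hq]; gcongr
            · linarith
            · exact Real.one_sub_le_exp_neg p
        _ = Real.exp ((N - 2 : ℕ) * (-p)) := by rw [Real.exp_nat_mul]
        _ ≤ _ := by
            apply Real.exp_le_exp.2
            rw [hNcast, hdd]
            have : (f : ℝ) ≤ N := by exact_mod_cast hfN
            nlinarith
    rw [Real.exp_add] at a1
    have a2 : Real.exp (2 * p) ≤ 2 := by
      have := hexp (2 * p) (by positivity) (by linarith); linarith
    have a3 : d * Real.exp (-(d / 2)) ≤ 1 := by
      have h2 : d ≤ Real.exp (d / 2) := by
        have h3 := Real.add_one_le_exp (d / 4)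
        have h4 : Real.exp (d / 2) = Real.exp (d / 4) ^ 2 := by
          rw [← Real.exp_nat_mul]; congr 1; push_cast; ring
        rw [h4]
        nlinarith [sq_nonneg (d / 4 - 1)]
      calc d * Real.exp (-(d / 2)) ≤ Real.exp (d / 2) * Real.exp (-(d / 2)) := by gcongr
        _ = 1 := by rw [← Real.exp_add]; simp
    calc d * q ≤ d * (Real.exp (-(d / 2)) * Real.exp (2 * p)) := by gcongr
      _ = (d * Real.exp (-(d / 2))) * Real.exp (2 * p) := by ring
      _ ≤ 1 * 2 := by gcongr
      _ = 2 := by ring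
  have hqE : E / 81 ≤ q ^ 2 := by
    have b1 : Real.exp (-(p + 2 * p ^ 2)) ≤ 1 - p := by
      have h3 := Real.add_one_le_exp (p + 2 * p ^ 2)
      rw [Real.exp_neg]
      rw [inv_le_comm₀ (Real.exp_pos _) (by linarith)]
      refine le_trans ?_ h3
      rw [inv_le_iff_one_le_mul₀ (by linarith)]
      nlinarith [mul_nonneg (sq_nonneg p) (show (0:ℝ) ≤ 1 - 2 * p by linarith)]
    have b2 : Real.exp (-d - 2) ≤ q := by
      calc Real.exp (-d - 2) ≤ Real.exp (n * (-(p + 2 * p ^ 2))) := by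
            apply Real.exp_le_exp.2; rw [hdd] at *; nlinarith
        _ = (Real.exp (-(p + 2 * p ^ 2))) ^ n := by rw [Real.exp_nat_mul]
        _ ≤ (1 - p) ^ n := by gcongr
        _ ≤ q := by
            rw [hq]; exact pow_le_pow_of_le_one (by linarith) (by linarith) (by omega)
    have b3 : E * Real.exp (-4) = Real.exp (-d - 2) ^ 2 := by
      rw [hE, ← Real.exp_add, ← Real.exp_nat_mul]; congr 1; push_cast; ring
    have b4 : (1 : ℝ) / 81 ≤ Real.exp (-4) := by
      rw [Real.exp_neg, one_div]
      apply inv_anti₀ (Real.exp_pos _)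
      have : Real.exp 4 = Real.exp 1 ^ 4 := by rw [← Real.exp_nat_mul]; norm_num
      rw [this]
      have h3 := Real.exp_one_lt_three
      calc Real.exp 1 ^ 4 ≤ 3 ^ 4 := by gcongr
        _ = 81 := by norm_num
    calc E / 81 = E * (1 / 81) := by ring
      _ ≤ E * Real.exp (-4) := by gcongr
      _ = Real.exp (-d - 2) ^ 2 := b3
      _ ≤ q ^ 2 := by gcongr
  have hfc : ((f - 1 : ℕ) : ℝ) = f - 1 := by push_cast [show 1 ≤ f by omega]; ring
  have hfn : (f : ℝ) ≤ n := by exact_mod_cast hfN.trans hNn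
  rw [hfc]
  have hfp : ((f : ℝ) - 1) * p ≤ d := by rw [hdd]; nlinarith
  have hfp' : d / 4 ≤ ((f : ℝ) - 1) * p := by rw [hdd]; nlinarith
  set A := (1 + p * (Real.exp l - 1)) ^ (f - 2) - 1
  set e2 := Real.exp (2 * l)
  set fp := ((f : ℝ) - 1) * p with hfpd
  have hfp0 : 0 ≤ fp := by linarith
  have k1 : fp * q * e2 * A ≤ 16 * (l * d) := by
    calc fp * q * e2 * A ≤ fp * q * e2 * (4 * (l * d)) := by gcongr
      _ ≤ (d * q) * e2 * (4 * (l * d)) := by gcongr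
      _ ≤ 2 * 2 * (4 * (l * d)) := by gcongr
      _ = _ := by ring
  have k2 : d * E / 5184 ≤ fp * e2 * (1 / 16 * q ^ 2) := by
    calc d * E / 5184 = d / 4 * 1 * (1 / 16 * (E / 81)) := by ring
      _ ≤ fp * e2 * (1 / 16 * q ^ 2) := by gcongr
  have k3 : (↑f - 1) * (p * q) * (e2 * (A - 1 / 16 * q)) =
      fp * q * e2 * A - fp * e2 * (1 / 16 * q ^ 2) := by rw [hfpd]; ring
  rw [k3]
  have : 0 < d * E := by positivity
  linarith

lemma QQ_bound (n : ℕ) (p : ℝ) (hn : 16 ≤ n) (h1 : 1 < n * p) (hp0 : 0 ≤ p) (hp4 : p ≤ 1 / 4)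
    (hd : (n * p) * p ≤ 1) (l : ℝ) (hl : l = 1 / 200000 * Real.exp (-(2 * (n * p)))) :
    ∀ (k : ℕ) (U F : Finset (Fin n)), U.card = k → F ⊆ U →
      QQ p U F ≤ Real.exp (l * ((n : ℝ) / 2 - F.card)) := by
  have hl0 : 0 ≤ l := by rw [hl]; positivity
  intro k
  induction k using Nat.strong_induction_on with
  | _ k ih =>
    intro U F hU hFU
    by_cases hf : (F.card : ℝ) ≤ n / 2
    · have a : QQ p U F ≤ 1 := by
        rw [← EG_one (n := n) p]
        exact EG_mono hp0 (by linarith) fun g => probT_le_one _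
      exact a.trans (Real.one_le_exp (mul_nonneg hl0 (by linarith)))
    · push Not at hf
      have hpos : 0 < F.card := by
        have : (0 : ℝ) < F.card := lt_of_le_of_lt (by positivity) hf
        exact_mod_cast this
      obtain ⟨v, hv⟩ := Finset.card_pos.1 hpos
      have s := step_bound (l := l) (f0 := (n : ℝ) / 2) hp0 (by linarith) U F hFU v hv
        (fun U' F' hlt hs => ih U'.card (by omega) U' F' rfl hs)
      refine s.trans ?_
      have := analytic n F.card U.card p hn h1 hp0 hp4 hd (Finset.card_le_card hFU)
        (by simpa using Finset.card_le_univ U) hf l hl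
      exact mul_le_of_le_one_right (Real.exp_pos _).le this

/-- **Medium connectivity, denser regime.** There are constants `c₀ > 0` and `N` such that
for all `n ≥ N` and all `p` with `1/n < p ≤ (log n)/n`, the probability that a random
`G(n,p)`-game has a pure Nash equilibrium is at most `exp(-c₀ n e^{-2np})`. -/
theorem stmt3 :
    ∃ c₀ : ℝ, 0 < c₀ ∧ ∃ N : ℕ, ∀ n : ℕ, N ≤ n →
      ∀ p : ℝ, 1 / (n : ℝ) < p → p ≤ Real.log n / n →
      probGT n p (fun g ω => ∃ σ, isPNE g ω σ) ≤
        Real.exp (-(c₀ * (n : ℝ) * Real.exp (-(2 * (n : ℝ) * p)))) := by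
  have hev : ∀ᶠ n : ℕ in Filter.atTop, Real.log n ^ 2 ≤ n := by
    have h := (Real.isLittleO_pow_log_id_atTop (n := 2)).bound (c := 1) one_pos
    have h2 := tendsto_natCast_atTop_atTop (R := ℝ) |>.eventually h
    filter_upwards [h2] with n hn
    simpa using hn
  obtain ⟨N₀, hN₀⟩ := Filter.eventually_atTop.1 hev
  refine ⟨1 / 400000, by norm_num, max N₀ 16, ?_⟩
  intro n hn p hp1 hp2
  have hn16 : 16 ≤ n := (le_max_right _ _).trans hn
  have hlog := hN₀ n ((le_max_left _ _).trans hn)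
  have hn' : (16 : ℝ) ≤ n := by exact_mod_cast hn16
  have hnpos : (0 : ℝ) < n := by linarith
  have h1 : 1 < n * p := by
    rw [div_lt_iff₀ hnpos] at hp1; linarith
  have hp0 : 0 ≤ p := le_trans (by positivity) hp1.le
  have h2 : n * p ≤ Real.log n := by
    rw [le_div_iff₀ hnpos] at hp2; linarith
  have h3 : (n * p) ^ 2 ≤ n := le_trans (by gcongr) hlog
  have hd : (n * p) * p ≤ 1 := by
    by_contra hc
    push Not at hc
    nlinarith
  have hp4 : p ≤ 1 / 4 := by
    by_contra hc
    push Not at hc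
    nlinarith [mul_pos hnpos hnpos]
  have hb := QQ_bound n p hn16 h1 hp0 hp4 hd _ rfl n Finset.univ Finset.univ (by simp)
    (Finset.Subset.refl _)
  have hle : probGT n p (fun g ω => ∃ σ, isPNE g ω σ) ≤ QQ (n := n) p Finset.univ Finset.univ := by
    unfold probGT QQ
    exact EG_mono hp0 (by linarith) fun g => probT_mono fun ω h => noMP_of_PNE g ω h
  refine (hle.trans hb).trans (le_of_eq ?_)
  congr 1
  simp only [Finset.card_univ, Fintype.card_fin]
  rw [show 2 * ((n : ℝ) * p) = 2 * n * p by ring]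
  ring
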